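/- arXiv:2312.08316 — 8 statements merged into one kernel-verified Lean document; each statement's English description precedes it below -/
import Mathlib

section
/- For every u ∈ S and every integer i with 0 ≤ i ≤ ⟨p, u⟩, both u + i·e₁ and u + i·e₂ lie in S (so the product formula is well defined). Moreover, for any two monoid homomorphisms x, y : (S, +) → (K, ·), the product x*y is again a monoid homomorphism (S, +) → (K, ·). -/
open Finset

/-- The monoid `S = σ∨ ∩ M` of lattice points of the dual cone: elements `u ∈ M` with
`⟨p_j, u⟩ ≥ 0` for all `j`. -/
def dualS {M : Type*} [AddCommGroup M] {m : ℕ} (p : Fin (m + 1) → (M →+ ℤ)) :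
    AddSubmonoid M where
  carrier := {u | ∀ j, 0 ≤ p j u}
  zero_mem' := fun j => by simp
  add_mem' := fun {u v} hu hv j => by
    rw [map_add]; exact add_nonneg (hu j) (hv j)

/-- A point of the affine toric variety `X_σ`: a monoid homomorphism `(S, +) → (K, ·)`. -/
def IsPoint {K M : Type*} [Field K] [AddCommGroup M] {m : ℕ}
    (p : Fin (m + 1) → (M →+ ℤ)) (x : dualS p → K) : Prop :=
  x 0 = 1 ∧ ∀ u v : dualS p, x (u + v) = x u * x v

open Classical in
/-- Extension of a function on `S` to all of `M` by zero. -/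
noncomputable def extend {K M : Type*} [Field K] [AddCommGroup M] {m : ℕ}
    (p : Fin (m + 1) → (M →+ ℤ)) (x : dualS p → K) : M → K :=
  fun v => if h : v ∈ dualS p then x ⟨v, h⟩ else 0

/-- `e` is a Demazure root corresponding to the distinguished ray spanned by `p 0`:
`⟨p 0, e⟩ = −1` and `⟨p j, e⟩ ≥ 0` for all other `j`. -/
def IsDemazureRoot {M : Type*} [AddCommGroup M] {m : ℕ}
    (p : Fin (m + 1) → (M →+ ℤ)) (e : M) : Prop :=
  p 0 e = -1 ∧ ∀ j, j ≠ 0 → 0 ≤ p j e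

/-- The product of two points:
`(x*y)(u) = Σ_{i+j=⟨p,u⟩} C(⟨p,u⟩,i) · x(u + i·e₂) · y(u + j·e₁)`. -/
noncomputable def prodPt {K M : Type*} [Field K] [AddCommGroup M] {m : ℕ}
    (p : Fin (m + 1) → (M →+ ℤ)) (e₁ e₂ : M) (x y : dualS p → K) : dualS p → K :=
  fun u => ∑ i ∈ Finset.range ((p 0 (u : M)).toNat + 1),
    ((p 0 (u : M)).toNat.choose i : K) *
      extend p x ((u : M) + i • e₂) *
      extend p y ((u : M) + ((p 0 (u : M)).toNat - i) • e₁)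

/-- The identity element `x_ρ` : `x_ρ(u) = 1` if `⟨p, u⟩ = 0` and `0` otherwise. -/
noncomputable def xrho {K M : Type*} [Field K] [AddCommGroup M] {m : ℕ}
    (p : Fin (m + 1) → (M →+ ℤ)) : dualS p → K :=
  fun u => if p 0 (u : M) = 0 then 1 else 0

/-- Binomial averaging with `a + b` steps is the composition of averaging with `a` and with
`b` steps. -/
theorem sum_choose_mul_sum_choose {R : Type*} [CommRing R] (a b : ℕ) (G : ℕ → R) :
    ∑ i ∈ Finset.range (a + 1), ∑ j ∈ Finset.range (b + 1),
        (a.choose i : R) * ((b.choose j : R) * G (i + j)) =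
      ∑ k ∈ Finset.range (a + b + 1), ((a + b).choose k : R) * G k := by
  induction a generalizing G with
  | zero => simp
  | succ a ih =>
    simp_rw [← Finset.mul_sum] at ih ⊢
    rw [Finset.sum_choose_succ_mul
      (fun i _ => ∑ j ∈ Finset.range (b + 1), (b.choose j : R) * G (i + j)), ih,
      Nat.add_right_comm a 1 b, Finset.sum_choose_succ_mul (fun i _ => G i),
      ← ih fun k => G (k + 1)]
    simp_rw [Nat.add_right_comm _ 1]

theorem add_nsmul_mem_dualS {M : Type*} [AddCommGroup M] {m : ℕ}
    {p : Fin (m + 1) → (M →+ ℤ)} {e u : M} (he : IsDemazureRoot p e) (hu : u ∈ dualS p)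
    {i : ℕ} (hi : (i : ℤ) ≤ p 0 u) : u + i • e ∈ dualS p := by
  intro j
  rw [map_add, map_nsmul, nsmul_eq_mul]
  by_cases hj : j = 0
  · subst hj
    rw [he.1]
    linarith
  · exact add_nonneg (hu j) (mul_nonneg (Int.natCast_nonneg i) (he.2 j hj))

theorem extend_of_mem {K M : Type*} [Field K] [AddCommGroup M] {m : ℕ}
    {p : Fin (m + 1) → (M →+ ℤ)} (x : dualS p → K) {u : M} (hu : u ∈ dualS p) :
    extend p x u = x ⟨u, hu⟩ :=
  dif_pos hu

theorem IsPoint.extend_add {K M : Type*} [Field K] [AddCommGroup M] {m : ℕ}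
    {p : Fin (m + 1) → (M →+ ℤ)} {x : dualS p → K} (hx : IsPoint p x) {u v : M}
    (hu : u ∈ dualS p) (hv : v ∈ dualS p) :
    extend p x (u + v) = extend p x u * extend p x v := by
  rw [extend_of_mem x hu, extend_of_mem x hv, extend_of_mem x (add_mem hu hv), ← hx.2]
  rfl

theorem IsPoint.extend_zero {K M : Type*} [Field K] [AddCommGroup M] {m : ℕ}
    {p : Fin (m + 1) → (M →+ ℤ)} {x : dualS p → K} (hx : IsPoint p x) :
    extend p x 0 = 1 := by
  rw [extend_of_mem x (zero_mem _)]
  exact hx.1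

theorem IsPoint.extend_add_nsmul {K M : Type*} [Field K] [AddCommGroup M] {m : ℕ}
    {p : Fin (m + 1) → (M →+ ℤ)} {x : dualS p → K} (hx : IsPoint p x) {e u v : M}
    (he : IsDemazureRoot p e) (hu : u ∈ dualS p) (hv : v ∈ dualS p) {i j : ℕ}
    (hi : (i : ℤ) ≤ p 0 u) (hj : (j : ℤ) ≤ p 0 v) :
    extend p x (u + v + (i + j) • e) = extend p x (u + i • e) * extend p x (v + j • e) := by
  rw [← hx.extend_add (add_nsmul_mem_dualS he hu hi) (add_nsmul_mem_dualS he hv hj), add_nsmul,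
    add_add_add_comm]

theorem IsPoint.prodPt {K M : Type*} [Field K] [AddCommGroup M] {m : ℕ}
    {p : Fin (m + 1) → (M →+ ℤ)} {e₁ e₂ : M} (he₁ : IsDemazureRoot p e₁)
    (he₂ : IsDemazureRoot p e₂) {x y : dualS p → K} (hx : IsPoint p x) (hy : IsPoint p y) :
    IsPoint p (prodPt p e₁ e₂ x y) := by
  refine ⟨by simp [_root_.prodPt, hx.extend_zero, hy.extend_zero], ?_⟩
  rintro ⟨u, hu⟩ ⟨v, hv⟩
  obtain ⟨a, ha⟩ := Int.eq_ofNat_of_zero_le (hu 0)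
  obtain ⟨b, hb⟩ := Int.eq_ofNat_of_zero_le (hv 0)
  have hab : (p 0 (u + v)).toNat = a + b := by
    rw [map_add, ha, hb]
    omega
  simp only [_root_.prodPt, AddSubmonoid.mk_add_mk, hab, ha, hb, Int.toNat_natCast, mul_assoc]
  rw [← sum_choose_mul_sum_choose a b fun k =>
    extend p x (u + v + k • e₂) * extend p y (u + v + (a + b - k) • e₁), Finset.sum_mul_sum]
  refine Finset.sum_congr rfl fun i hi => Finset.sum_congr rfl fun j hj => ?_
  rw [Finset.mem_range] at hi hj
  rw [show a + b - (i + j) = (a - i) + (b - j) by omega,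
    hx.extend_add_nsmul he₂ hu hv (by omega) (by omega),
    hy.extend_add_nsmul he₁ hu hv (by omega) (by omega)]
  ring

/-- For every `u ∈ S` and every `i` with `0 ≤ i ≤ ⟨p, u⟩`, both `u + i·e₁`
and `u + i·e₂` lie in `S` (so the product formula is well defined); moreover the product of two
monoid homomorphisms `(S,+) → (K,·)` is again a monoid homomorphism. -/
theorem stmt_2 {K M : Type*} [Field K] [IsAlgClosed K] [CharZero K]
    [AddCommGroup M] [Module.Free ℤ M] [Module.Finite ℤ M] {m : ℕ}
    (p : Fin (m + 1) → (M →+ ℤ)) (e₁ e₂ : M)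
    (he₁ : IsDemazureRoot p e₁) (he₂ : IsDemazureRoot p e₂) :
    (∀ u ∈ dualS p, ∀ i : ℕ, (i : ℤ) ≤ p 0 u →
        u + i • e₁ ∈ dualS p ∧ u + i • e₂ ∈ dualS p) ∧
    (∀ x y : dualS p → K, IsPoint p x → IsPoint p y →
        IsPoint p (prodPt p e₁ e₂ x y)) := by
  exact ⟨fun u hu i hi => ⟨add_nsmul_mem_dualS he₁ hu hi, add_nsmul_mem_dualS he₂ hu hi⟩,
    fun x y hx hy => hx.prodPt he₁ he₂ hy⟩
end

section
/- The map x_ρ : S → K defined by x_ρ(u) = 1 if ⟨p, u⟩ = 0 and x_ρ(u) = 0 otherwise is a monoid homomorphism (S, +) → (K, ·), and it is a two-sided identity for the product *: for every monoid homomorphism x : (S, +) → (K, ·), x * x_ρ = x_ρ * x = x. -/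
open Finset

theorem xrho_isPoint {K M : Type*} [Field K] [AddCommGroup M] {m : ℕ}
    (p : Fin (m + 1) → (M →+ ℤ)) : IsPoint p (xrho (K := K) p) := by
  refine ⟨by simp [xrho], fun u v => ?_⟩
  have hu : 0 ≤ p 0 (u : M) := u.2 0
  have hv : 0 ≤ p 0 (v : M) := v.2 0
  simp only [xrho, AddSubmonoid.coe_add, map_add, add_eq_zero_iff_of_nonneg hu hv]
  by_cases h : p 0 (u : M) = 0 <;> simp [h]

theorem extend_coe {K M : Type*} [Field K] [AddCommGroup M] {m : ℕ}
    (p : Fin (m + 1) → (M →+ ℤ)) (x : dualS p → K) (u : dualS p) :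
    extend p x (u : M) = x u := by
  simp [extend]

/-- Moving `u ∈ S` by `k ≤ ⟨p 0, u⟩` steps along a Demazure root stays in `S`, and the value of
`x_ρ` there detects whether all of `⟨p 0, u⟩` has been used up. -/
theorem extend_xrho_add_nsmul {K M : Type*} [Field K] [AddCommGroup M] {m : ℕ}
    {p : Fin (m + 1) → (M →+ ℤ)} {e : M} (he : IsDemazureRoot p e) (u : dualS p)
    {k : ℕ} (hk : k ≤ (p 0 (u : M)).toNat) :
    extend p (xrho (K := K) p) ((u : M) + k • e) =
      if k = (p 0 (u : M)).toNat then 1 else 0 := by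
  have hu : 0 ≤ p 0 (u : M) := u.2 0
  have h0 : p 0 ((u : M) + k • e) = p 0 (u : M) - k := by
    simp [he.1, sub_eq_add_neg]
  have hmem : (u : M) + k • e ∈ dualS p := by
    intro j
    by_cases hj : j = 0
    · subst hj
      rw [h0]
      omega
    · rw [map_add, map_nsmul]
      exact add_nonneg (u.2 j) (nsmul_nonneg (he.2 j hj) k)
  rw [extend, dif_pos hmem, xrho]
  simp only [h0]
  exact if_congr (by omega) rfl rfl

theorem prodPt_xrho {K M : Type*} [Field K] [AddCommGroup M] {m : ℕ}
    {p : Fin (m + 1) → (M →+ ℤ)} {e₁ : M} (he₁ : IsDemazureRoot p e₁) (e₂ : M)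
    (x : dualS p → K) : prodPt p e₁ e₂ x (xrho p) = x := by
  funext u
  rw [prodPt, Finset.sum_eq_single 0]
  · simp [extend_xrho_add_nsmul he₁ u le_rfl, extend_coe]
  · intro i hi hi0
    rw [extend_xrho_add_nsmul he₁ u (Nat.sub_le _ _), if_neg, mul_zero]
    rw [Finset.mem_range] at hi
    omega
  · simp

theorem xrho_prodPt {K M : Type*} [Field K] [AddCommGroup M] {m : ℕ}
    {p : Fin (m + 1) → (M →+ ℤ)} (e₁ : M) {e₂ : M} (he₂ : IsDemazureRoot p e₂)
    (x : dualS p → K) : prodPt p e₁ e₂ (xrho p) x = x := by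
  funext u
  rw [prodPt, Finset.sum_eq_single (p 0 (u : M)).toNat]
  · simp [extend_xrho_add_nsmul he₂ u le_rfl, extend_coe]
  · intro i hi hin
    rw [Finset.mem_range] at hi
    rw [extend_xrho_add_nsmul he₂ u (by omega), if_neg hin, mul_zero, zero_mul]
  · simp

/-- The map `x_ρ` (`x_ρ(u) = 1` if `⟨p,u⟩ = 0`, else `0`) is a monoid
homomorphism `(S, +) → (K, ·)` and a two-sided identity for the product `*`. -/
theorem stmt_4 {K M : Type*} [Field K] [IsAlgClosed K] [CharZero K]
    [AddCommGroup M] [Module.Free ℤ M] [Module.Finite ℤ M] {m : ℕ}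
    (p : Fin (m + 1) → (M →+ ℤ)) (e₁ e₂ : M)
    (he₁ : IsDemazureRoot p e₁) (he₂ : IsDemazureRoot p e₂) :
    IsPoint p (xrho (K := K) p) ∧
    ∀ x : dualS p → K, IsPoint p x →
      prodPt p e₁ e₂ x (xrho p) = x ∧ prodPt p e₁ e₂ (xrho p) x = x := by
  exact ⟨xrho_isPoint p, fun x _ => ⟨prodPt_xrho he₁ e₂ x, xrho_prodPt e₁ he₂ x⟩⟩
end

section
/- Suppose p ∈ γ (i.e. the ray ρ spanned by p is a ray of the face γ). Then the map x_γ : S → K defined by x_γ(u) = 1 if u ∈ γ^⊥ and x_γ(u) = 0 otherwise is a monoid homomorphism (S, +) → (K, ·) lying in the orbit O_γ, it is an idempotent (x_γ * x_γ = x_γ), and it is the unique idempotent in O_γ: any x ∈ O_γ with x*x = x equals x_γ. -/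
open Finset

/-- For a face `γ` of `σ` cut out by a supporting lattice vector `w` (i.e. `⟨p_j, w⟩ ≥ 0` for
all `j`, and `γ` is generated by those `p_j` with `⟨p_j, w⟩ = 0`), the lattice part of
`γ^⊥ = {u : ⟨v, u⟩ = 0 for all v ∈ γ}`. -/
def gPerp {M : Type*} [AddCommGroup M] {m : ℕ}
    (p : Fin (m + 1) → (M →+ ℤ)) (w : M) : Set M :=
  {u | ∀ j, p j w = 0 → p j u = 0}

/-- `x` lies in the torus orbit `O_γ`: for `u ∈ S`, `x(u) ≠ 0` exactly when `u ∈ γ^⊥`. -/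
def inOrbit {K M : Type*} [Field K] [AddCommGroup M] {m : ℕ}
    (p : Fin (m + 1) → (M →+ ℤ)) (w : M) (x : dualS p → K) : Prop :=
  ∀ u : dualS p, x u ≠ 0 ↔ (u : M) ∈ gPerp p w

theorem mem_gPerp_add_iff {M : Type*} [AddCommGroup M] {m : ℕ}
    (p : Fin (m + 1) → (M →+ ℤ)) (w : M) (u v : dualS p) :
    ((u + v : dualS p) : M) ∈ gPerp p w ↔ (u : M) ∈ gPerp p w ∧ (v : M) ∈ gPerp p w := by
  constructor
  · intro h
    have key : ∀ j, p j w = 0 → p j (u : M) = 0 ∧ p j (v : M) = 0 := fun j hj => by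
      have h1 := h j hj
      have hu : 0 ≤ p j (u : M) := u.2 j
      have hv : 0 ≤ p j (v : M) := v.2 j
      rw [AddSubmonoid.coe_add, map_add] at h1
      constructor <;> omega
    exact ⟨fun j hj => (key j hj).1, fun j hj => (key j hj).2⟩
  · rintro ⟨hu, hv⟩ j hj
    rw [AddSubmonoid.coe_add, map_add, hu j hj, hv j hj, add_zero]

theorem extend_eq_zero {K M : Type*} [Field K] [AddCommGroup M] {m : ℕ}
    (p : Fin (m + 1) → (M →+ ℤ)) (x : dualS p → K)
    (hx : ∀ u : dualS p, p 0 (u : M) ≠ 0 → x u = 0) {v : M} (hv : p 0 v ≠ 0) :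
    extend p x v = 0 := by
  unfold extend
  split_ifs with h
  · exact hx ⟨v, h⟩ hv
  · rfl

/-- On lattice points orthogonal to the distinguished ray the product is pointwise. -/
theorem prodPt_apply_of_eq_zero {K M : Type*} [Field K] [AddCommGroup M] {m : ℕ}
    (p : Fin (m + 1) → (M →+ ℤ)) (e₁ e₂ : M) (x y : dualS p → K) (u : dualS p)
    (hu : p 0 (u : M) = 0) : prodPt p e₁ e₂ x y u = x u * y u := by
  simp [prodPt, hu, extend_coe]

/-- The product of two functions supported on the hyperplane orthogonal to the distinguished ray
is supported there as well. -/
theorem prodPt_apply_of_ne_zero {K M : Type*} [Field K] [AddCommGroup M] {m : ℕ}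
    (p : Fin (m + 1) → (M →+ ℤ)) {e₁ e₂ : M} (he₁ : p 0 e₁ = -1) (he₂ : p 0 e₂ = -1)
    (x y : dualS p → K)
    (hx : ∀ u : dualS p, p 0 (u : M) ≠ 0 → x u = 0)
    (hy : ∀ u : dualS p, p 0 (u : M) ≠ 0 → y u = 0)
    (u : dualS p) (hu : p 0 (u : M) ≠ 0) : prodPt p e₁ e₂ x y u = 0 := by
  refine Finset.sum_eq_zero fun i _ => ?_
  have hu0 : 0 ≤ p 0 (u : M) := u.2 0
  by_cases hi : p 0 (u : M) = i
  · rw [extend_eq_zero p y hy, mul_zero]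
    rw [map_add, map_nsmul, he₁, hi]
    simp only [Int.toNat_natCast, Nat.sub_self, zero_nsmul]
    omega
  · rw [extend_eq_zero p x hx, mul_zero, zero_mul]
    rw [map_add, map_nsmul, he₂, nsmul_eq_mul]
    omega

open Classical in
/-- Suppose the ray `ρ` spanned by `p` is a ray of the face `γ`
(equivalently `⟨p, w⟩ = 0`, i.e. `p ∈ γ`).  Then `x_γ` (the indicator of `γ^⊥ ∩ S`) is a
monoid homomorphism `(S,+) → (K,·)` lying in the orbit `O_γ`, it is an idempotent, and it is
the unique idempotent in `O_γ`. -/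
theorem stmt_10 {K M : Type*} [Field K] [IsAlgClosed K] [CharZero K]
    [AddCommGroup M] [Module.Free ℤ M] [Module.Finite ℤ M] {m : ℕ}
    (p : Fin (m + 1) → (M →+ ℤ)) (e₁ e₂ : M)
    (he₁ : IsDemazureRoot p e₁) (he₂ : IsDemazureRoot p e₂)
    (w : M) (hw : ∀ j, 0 ≤ p j w) (hpγ : p 0 w = 0) :
    IsPoint p (fun u : dualS p => if (u : M) ∈ gPerp p w then (1 : K) else 0) ∧
    inOrbit p w (fun u : dualS p => if (u : M) ∈ gPerp p w then (1 : K) else 0) ∧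
    prodPt p e₁ e₂ (fun u : dualS p => if (u : M) ∈ gPerp p w then (1 : K) else 0)
        (fun u : dualS p => if (u : M) ∈ gPerp p w then (1 : K) else 0)
      = (fun u : dualS p => if (u : M) ∈ gPerp p w then (1 : K) else 0) ∧
    (∀ x : dualS p → K, IsPoint p x → inOrbit p w x → prodPt p e₁ e₂ x x = x →
      x = fun u : dualS p => if (u : M) ∈ gPerp p w then (1 : K) else 0) := by
  have hp : ∀ {u : M}, u ∈ gPerp p w → p 0 u = 0 := fun h => h 0 hpγ
  refine ⟨⟨?_, fun u v => ?_⟩, fun u => by simp, ?_, fun x _ hx hxx => ?_⟩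
  · exact if_pos fun j _ => map_zero (p j)
  · simp only [mem_gPerp_add_iff, ite_and, ite_mul, one_mul, zero_mul]
  · funext u
    by_cases hu : p 0 (u : M) = 0
    · rw [prodPt_apply_of_eq_zero p e₁ e₂ _ _ u hu]
      simp
    · have hsupp : ∀ v : dualS p, p 0 (v : M) ≠ 0 →
          (if (v : M) ∈ gPerp p w then (1 : K) else 0) = 0 :=
        fun v hv => if_neg fun h => hv (hp h)
      rw [prodPt_apply_of_ne_zero p he₁.1 he₂.1 _ _ hsupp hsupp u hu, hsupp u hu]
  · funext u
    split_ifs with hu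
    · have h := congrFun hxx u
      rw [prodPt_apply_of_eq_zero p e₁ e₂ x x u (hp hu)] at h
      exact mul_eq_left₀ ((hx u).2 hu) |>.1 h
    · exact not_not.1 fun h => hu ((hx u).1 h)
end

section
/- Suppose p ∉ γ, e₁ ∉ γ^⊥, and e₂ ∉ γ^⊥. Then the orbit O_γ contains no idempotent: no monoid homomorphism x : (S, +) → (K, ·) with (x(u) ≠ 0 exactly when u ∈ γ^⊥, for u ∈ S) satisfies x*x = x. -/
open Finset

/-- If `x` lies in `O_γ`, then `x` vanishes at every translate of `w` by a positive multiple of a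
vector outside `γ^⊥`. -/
theorem inOrbit.extend_add_nsmul_eq_zero {K M : Type*} [Field K] [AddCommGroup M] {m : ℕ}
    {p : Fin (m + 1) → (M →+ ℤ)} {w : M} {x : dualS p → K} (hx : inOrbit p w x)
    {e : M} (he : e ∉ gPerp p w) {n : ℕ} (hn : n ≠ 0) :
    extend p x (w + n • e) = 0 := by
  unfold extend
  split_ifs with h
  · by_contra hne
    refine he fun j hj => ?_
    have h0 := (hx ⟨_, h⟩).1 hne j hj
    simpa [hj, hn] using h0
  · rfl

/-- Suppose `p ∉ γ` (i.e. `⟨p, w⟩ ≠ 0`), `e₁ ∉ γ^⊥`, and `e₂ ∉ γ^⊥`.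
Then the orbit `O_γ` contains no idempotent. -/
theorem stmt_11 {K M : Type*} [Field K] [IsAlgClosed K] [CharZero K]
    [AddCommGroup M] [Module.Free ℤ M] [Module.Finite ℤ M] {m : ℕ}
    (p : Fin (m + 1) → (M →+ ℤ)) (e₁ e₂ : M)
    (he₁ : IsDemazureRoot p e₁) (he₂ : IsDemazureRoot p e₂)
    (w : M) (hw : ∀ j, 0 ≤ p j w) (hpγ : p 0 w ≠ 0)
    (h₁ : e₁ ∉ gPerp p w) (h₂ : e₂ ∉ gPerp p w) :
    ¬ ∃ x : dualS p → K, IsPoint p x ∧ inOrbit p w x ∧ prodPt p e₁ e₂ x x = x := by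
  rintro ⟨x, -, hx, hxx⟩
  have hd : (p 0 w).toNat ≠ 0 := by
    have := hw 0
    omega
  refine (hx ⟨w, hw⟩).2 (fun _ hj => hj) ?_
  rw [← hxx]
  refine Finset.sum_eq_zero fun i _ => ?_
  rcases eq_or_ne i 0 with rfl | hi
  · rw [hx.extend_add_nsmul_eq_zero h₁ (by simpa using hd), mul_zero]
  · rw [hx.extend_add_nsmul_eq_zero h₂ hi, mul_zero, zero_mul]
end

section
/- Suppose p ∉ γ and exactly one of the Demazure roots lies in γ^⊥, say e₂ ∈ γ^⊥ and e₁ ∉ γ^⊥. Then a point x ∈ O_γ is an idempotent (x*x = x) if and only if x(u) = 1 for every u ∈ S with u ∈ γ^⊥ and ⟨p, u⟩ = 0. -/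
open Finset

/-- A lattice point of `S` moved by at most `⟨p, u⟩` steps along a Demazure root stays in `S`. -/
theorem IsDemazureRoot.add_nsmul_mem {M : Type*} [AddCommGroup M] {m : ℕ}
    {p : Fin (m + 1) → (M →+ ℤ)} {e : M} (he : IsDemazureRoot p e) (u : dualS p) {k : ℕ}
    (hk : k ≤ (p 0 (u : M)).toNat) : (u : M) + k • e ∈ dualS p := by
  intro j
  have hu : 0 ≤ p j (u : M) := u.2 j
  rw [map_add, map_nsmul, nsmul_eq_mul]
  by_cases hj : j = 0
  · subst hj
    rw [he.1]
    omega
  · exact add_nonneg hu (mul_nonneg (Int.natCast_nonneg k) (he.2 j hj))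

/-- Moving along a Demazure root outside `γ^⊥` leaves `γ^⊥` when `p ∉ γ`. -/
theorem IsDemazureRoot.add_nsmul_notMem_gPerp {M : Type*} [AddCommGroup M] {m : ℕ}
    {p : Fin (m + 1) → (M →+ ℤ)} {e w : M} (he : IsDemazureRoot p e) (hpγ : p 0 w ≠ 0)
    (h : e ∉ gPerp p w) (u : dualS p) {k : ℕ} (hk : k ≠ 0) :
    (u : M) + k • e ∉ gPerp p w := by
  intro hmem
  refine h fun j hj => ?_
  have hj0 : j ≠ 0 := by
    rintro rfl
    exact hpγ hj
  have hsum := hmem j hj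
  have hu : 0 ≤ p j (u : M) := u.2 j
  have hej := he.2 j hj0
  rw [map_add, map_nsmul, nsmul_eq_mul] at hsum
  have hke : (k : ℤ) * p j e = 0 := by
    have := mul_nonneg (Int.natCast_nonneg k) hej
    linarith
  exact (mul_eq_zero.mp hke).resolve_left (by exact_mod_cast hk)

/-- If `p ∉ γ` and `e₁ ∉ γ^⊥`, only the summand with `j = 0` of the product survives on `O_γ`. -/
theorem prodPt_apply_of_notMem_gPerp {K M : Type*} [Field K] [AddCommGroup M] {m : ℕ}
    {p : Fin (m + 1) → (M →+ ℤ)} {e₁ w : M} (he₁ : IsDemazureRoot p e₁) (e₂ : M)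
    (hpγ : p 0 w ≠ 0) (h₁ : e₁ ∉ gPerp p w) (x : dualS p → K) {y : dualS p → K}
    (hy : inOrbit p w y) (u : dualS p) :
    prodPt p e₁ e₂ x y u = extend p x ((u : M) + (p 0 (u : M)).toNat • e₂) * y u := by
  unfold prodPt
  rw [Finset.sum_range_succ, Finset.sum_eq_zero]
  · simp [extend_coe]
  · intro i hi
    have hk : (p 0 (u : M)).toNat - i ≠ 0 := by
      have := Finset.mem_range.mp hi
      omega
    have hmem := he₁.add_nsmul_mem u (Nat.sub_le (p 0 (u : M)).toNat i)
    have hzero : y ⟨_, hmem⟩ = 0 :=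
      not_not.mp fun h => he₁.add_nsmul_notMem_gPerp hpγ h₁ u hk ((hy ⟨_, hmem⟩).mp h)
    have hext := extend_coe p y ⟨_, hmem⟩
    rw [hzero] at hext
    rw [hext, mul_zero]

/-- Suppose `p ∉ γ` (i.e. `⟨p, w⟩ ≠ 0`) and exactly one Demazure root lies
in `γ^⊥`, say `e₂ ∈ γ^⊥` and `e₁ ∉ γ^⊥`.  Then a point `x ∈ O_γ` is an idempotent iff
`x(u) = 1` for every `u ∈ S` with `u ∈ γ^⊥` and `⟨p, u⟩ = 0`. -/
theorem stmt_13 {K M : Type*} [Field K] [IsAlgClosed K] [CharZero K]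
    [AddCommGroup M] [Module.Free ℤ M] [Module.Finite ℤ M] {m : ℕ}
    (p : Fin (m + 1) → (M →+ ℤ)) (e₁ e₂ : M)
    (he₁ : IsDemazureRoot p e₁) (he₂ : IsDemazureRoot p e₂)
    (w : M) (hw : ∀ j, 0 ≤ p j w) (hpγ : p 0 w ≠ 0)
    (h₁ : e₁ ∉ gPerp p w) (h₂ : e₂ ∈ gPerp p w)
    (x : dualS p → K) (hx : IsPoint p x) (hxO : inOrbit p w x) :
    prodPt p e₁ e₂ x x = x ↔
      ∀ u : dualS p, (u : M) ∈ gPerp p w → p 0 (u : M) = 0 → x u = 1 := by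
  have hprod := prodPt_apply_of_notMem_gPerp he₁ e₂ hpγ h₁ x hxO
  constructor
  · intro hidem u hu hpu
    have hxu := congrFun hidem u
    rw [hprod, hpu] at hxu
    simp only [Int.toNat_zero, zero_smul, add_zero, extend_coe] at hxu
    exact mul_right_cancel₀ ((hxO u).mpr hu) (by rw [hxu, one_mul])
  · intro hone
    funext u
    rw [hprod]
    by_cases hu : (u : M) ∈ gPerp p w
    · have hmem := he₂.add_nsmul_mem u le_rfl
      have hval : x ⟨_, hmem⟩ = 1 := by
        refine hone ⟨_, hmem⟩ (fun j hj => ?_) ?_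
        · simp [hu j hj, h₂ j hj]
        · have hu0 : 0 ≤ p 0 (u : M) := u.2 0
          simp [he₂.1, Int.toNat_of_nonneg hu0]
      have hext := extend_coe p x ⟨_, hmem⟩
      rw [hval] at hext
      rw [hext, one_mul]
    · have hxu : x u = 0 := not_not.mp fun h => hu ((hxO u).mp h)
      rw [hxu, mul_zero]
end

section
/- Let K be a field of characteristic zero, n ≥ 1, and a₁, …, a_{n−1}, b₁, …, b_{n−1} nonnegative integers. Define an operation * on Kⁿ by (x * y)_i = x_i·y_i for 1 ≤ i ≤ n−1 and (x * y)_n = (x₁^{a₁}⋯x_{n−1}^{a_{n−1}})·y_n + (y₁^{b₁}⋯y_{n−1}^{b_{n−1}})·x_n. Then * is associative, the element (1, …, 1, 0) is a two-sided identity, and an element x ∈ Kⁿ is invertible for * if and only if x_i ≠ 0 for all 1 ≤ i ≤ n−1. -/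
/-- The corank-one multiplication on `Kⁿ = K^{n−1} × K` (with `n = m + 1`):
`(x * y)ᵢ = xᵢ yᵢ` for `i ≤ n−1` and
`(x * y)ₙ = (∏ᵢ xᵢ^{aᵢ}) yₙ + (∏ᵢ yᵢ^{bᵢ}) xₙ`. -/
def cmul {K : Type*} [Field K] {m : ℕ} (a b : Fin m → ℕ)
    (x y : (Fin m → K) × K) : (Fin m → K) × K :=
  (fun i => x.1 i * y.1 i,
    (∏ i, x.1 i ^ a i) * y.2 + (∏ i, y.1 i ^ b i) * x.2)

/-- For a field `K` of characteristic zero and `n = m + 1 ≥ 1`, the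
operation `*` on `Kⁿ` is associative, `(1, …, 1, 0)` is a two-sided identity, and `x` is
invertible iff `xᵢ ≠ 0` for all `1 ≤ i ≤ n − 1`. -/
theorem stmt_14 {K : Type*} [Field K] [CharZero K] {m : ℕ} (a b : Fin m → ℕ) :
    (∀ x y z : (Fin m → K) × K, cmul a b (cmul a b x y) z = cmul a b x (cmul a b y z)) ∧
    (∀ x : (Fin m → K) × K,
      cmul a b x (fun _ => 1, 0) = x ∧ cmul a b (fun _ => 1, 0) x = x) ∧
    (∀ x : (Fin m → K) × K,
      (∃ y, cmul a b x y = (fun _ => 1, 0) ∧ cmul a b y x = (fun _ => 1, 0)) ↔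
        ∀ i, x.1 i ≠ 0) := by
  refine ⟨fun x y z => ?_, fun x => ?_, fun x => ⟨?_, fun hx => ?_⟩⟩
  · ext <;> simp only [cmul, mul_pow, Finset.prod_mul_distrib] <;> ring
  · constructor <;> ext <;> simp [cmul]
  · rintro ⟨y, hy, -⟩ i
    have hi : x.1 i * y.1 i = 1 := congrFun (congrArg Prod.fst hy) i
    exact left_ne_zero_of_mul_eq_one hi
  · have ha : ∏ i, x.1 i ^ a i ≠ 0 :=
      Finset.prod_ne_zero_iff.2 fun i _ => pow_ne_zero _ (hx i)
    have hb : ∏ i, x.1 i ^ b i ≠ 0 :=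
      Finset.prod_ne_zero_iff.2 fun i _ => pow_ne_zero _ (hx i)
    refine ⟨(fun i => (x.1 i)⁻¹, -((∏ i, x.1 i ^ a i)⁻¹ * (∏ i, x.1 i ^ b i)⁻¹ * x.2)),
      Prod.ext (funext fun i => mul_inv_cancel₀ (hx i)) ?_,
      Prod.ext (funext fun i => inv_mul_cancel₀ (hx i)) ?_⟩ <;>
    · simp only [cmul, inv_pow, Finset.prod_inv_distrib]
      field_simp
      ring
end

section
/- Let K be a field of characteristic zero, n ≥ 1, and consider the monoid (Kⁿ, *) with (x * y)_i = x_i y_i for i ≤ n−1 and (x * y)_n = (∏_{i<n} x_i^{a_i})·y_n + (∏_{i<n} y_i^{b_i})·x_n. This monoid admits a zero element (an element z with z * x = x * z = z for all x ∈ Kⁿ) if and only if some a_i > 0 and some b_j > 0; in that case the zero element is (0, …, 0). -/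
/-- The monoid `(Kⁿ, *)` (with `n = m + 1`, `K` of characteristic zero)
admits a zero element iff some `aᵢ > 0` and some `bⱼ > 0`; in that case the zero element is
`(0, …, 0)`. -/
theorem stmt_15 {K : Type*} [Field K] [CharZero K] {m : ℕ} (a b : Fin m → ℕ) :
    ((∃ z : (Fin m → K) × K, ∀ x : (Fin m → K) × K,
        cmul a b z x = z ∧ cmul a b x z = z) ↔
      ((∃ i, 0 < a i) ∧ (∃ j, 0 < b j))) ∧
    (((∃ i, 0 < a i) ∧ (∃ j, 0 < b j)) →
      ∀ x : (Fin m → K) × K,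
        cmul a b (fun _ => 0, 0) x = (fun _ => 0, 0) ∧
        cmul a b x (fun _ => 0, 0) = (fun _ => 0, 0)) := by
  have zero_law (h : (∃ i, 0 < a i) ∧ (∃ j, 0 < b j)) (x : (Fin m → K) × K) :
      cmul a b (fun _ => 0, 0) x = (fun _ => 0, 0) ∧
      cmul a b x (fun _ => 0, 0) = (fun _ => 0, 0) := by
    obtain ⟨⟨i, hi⟩, j, hj⟩ := h
    have ha : ∏ i, (0 : K) ^ a i = 0 :=
      Finset.prod_eq_zero (Finset.mem_univ i) (zero_pow hi.ne')
    have hb : ∏ j, (0 : K) ^ b j = 0 :=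
      Finset.prod_eq_zero (Finset.mem_univ j) (zero_pow hj.ne')
    simp only [cmul, ha, hb, zero_mul, mul_zero, add_zero, and_self]
  have exists_pos {c : Fin m → ℕ} {v : Fin m → K} (h : ∏ i, v i ^ c i = 0) :
      ∃ i, 0 < c i := by
    obtain ⟨i, -, hi⟩ := Finset.prod_eq_zero_iff.mp h
    exact ⟨i, Nat.pos_of_ne_zero fun hc => by simp [hc] at hi⟩
  refine ⟨⟨?_, fun h => ⟨_, zero_law h⟩⟩, zero_law⟩
  rintro ⟨z, hz⟩
  obtain ⟨hl, hr⟩ := hz (fun _ => 1, 1)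
  have hl := congrArg Prod.snd hl
  have hr := congrArg Prod.snd hr
  simp only [cmul, one_pow, Finset.prod_const_one, one_mul, mul_one] at hl hr
  exact ⟨exists_pos (add_eq_right.mp hl), exists_pos (add_eq_left.mp hr)⟩
end

section
/- Let K be a field of characteristic zero, n ≥ 1, and consider the monoid (Kⁿ, *) with (x * y)_i = x_i y_i for i ≤ n−1 and (x * y)_n = (∏_{i<n} x_i^{a_i})·y_n + (∏_{i<n} y_i^{b_i})·x_n. Assume (a₁, …, a_{n−1}) ≠ (b₁, …, b_{n−1}) (so the monoid is noncommutative). Then the center {x ∈ Kⁿ : x * y = y * x for all y ∈ Kⁿ} equals {x ∈ Kⁿ : x_n = 0 and ∏_{i<n} x_i^{a_i} = ∏_{i<n} x_i^{b_i}}. -/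
/-- Assume `(a₁, …, a_{n−1}) ≠ (b₁, …, b_{n−1})`, so the monoid `(Kⁿ, *)`
(`n = m + 1`, `K` of characteristic zero) is noncommutative.  Its center equals
`{x : xₙ = 0 and ∏ᵢ xᵢ^{aᵢ} = ∏ᵢ xᵢ^{bᵢ}}`. -/
theorem stmt_16 {K : Type*} [Field K] [CharZero K] {m : ℕ} (a b : Fin m → ℕ)
    (hab : a ≠ b) :
    {x : (Fin m → K) × K | ∀ y, cmul a b x y = cmul a b y x} =
      {x : (Fin m → K) × K | x.2 = 0 ∧ (∏ i, x.1 i ^ a i) = ∏ i, x.1 i ^ b i} := by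
  ext x
  simp only [Set.mem_ofPred_eq]
  constructor
  · intro h
    refine ⟨?_, ?_⟩
    · obtain ⟨i, hi⟩ := Function.ne_iff.mp hab
      have key := congrArg Prod.snd (h (Function.update 1 i 2, 0))
      have prod_eq (c : Fin m → ℕ) :
          ∏ j, (Function.update (1 : Fin m → K) i 2) j ^ c j = 2 ^ c i := by
        rw [Finset.prod_eq_single i]
        · simp
        · intro j _ hj
          simp [hj]
        · simp
      simp only [cmul, prod_eq, mul_zero, zero_add, add_zero] at key
      by_contra hx
      have hpow : (2 : K) ^ b i = 2 ^ a i := mul_right_cancel₀ hx key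
      have hpow' : 2 ^ b i = 2 ^ a i := by exact_mod_cast hpow
      exact hi (Nat.pow_right_injective le_rfl hpow').symm
    · have key := congrArg Prod.snd (h (1, 1))
      simp only [cmul, Pi.one_apply, one_pow, Finset.prod_const_one, mul_one, one_mul] at key
      linear_combination key
  · rintro ⟨hx, hX⟩ y
    refine Prod.ext (funext fun i => mul_comm _ _) ?_
    simp [cmul, hx, hX]
end
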